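/- Petersen's theorem: Let μ be a Radon measure on ℝ^d such that every polynomial is μ-integrable. For j = 1,…,d let π_j(μ) be the j-th marginal measure, i.e. the pushforward of μ under the coordinate projection (x₁,…,x_d) ↦ x_j. If each marginal measure π_j(μ) is determinate as a measure on ℝ, then μ is determinate: every Radon measure ν on ℝ^d for which all polynomials are ν-integrable and ∫ x^α dν = ∫ x^α dμ for all α ∈ ℕ₀^d equals μ. -/

import Mathlib

open MeasureTheory

/-- A Radon measure: finite on compact sets and inner regular with respect to compact sets. -/
def IsRadon {X : Type*} [TopologicalSpace X] [MeasurableSpace X] (μ : Measure X) : Prop :=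
  IsFiniteMeasureOnCompacts μ ∧ μ.InnerRegular

/-- A Radon measure on `ℝ` with all moments finite is determinate if it is uniquely
determined by its moments among such measures. -/
def Determinate1D (τ : Measure ℝ) : Prop :=
  ∀ ρ : Measure ℝ, IsRadon ρ → (∀ n : ℕ, Integrable (fun y : ℝ => y ^ n) ρ) →
    (∀ n : ℕ, ∫ y : ℝ, y ^ n ∂ρ = ∫ y : ℝ, y ^ n ∂τ) → ρ = τ

open Polynomial in
lemma sos_aux (n : ℕ) : ∀ p : ℝ[X], p.natDegree ≤ n → (∀ x, 0 ≤ p.eval x) →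
    ∃ a b : ℝ[X], p = a ^ 2 + b ^ 2 := by
  induction n using Nat.strong_induction_on with
  | _ n ih =>
  intro p hn hp
  by_cases hd : p.natDegree = 0
  · obtain ⟨c, rfl⟩ := natDegree_eq_zero.mp hd
    have hc : 0 ≤ c := by simpa using hp 0
    exact ⟨C (Real.sqrt c), 0, by rw [← C_pow, Real.sq_sqrt hc]; simp⟩
  have hp0 : p ≠ 0 := by rintro rfl; simp at hd
  -- division by a monic quadratic which is a sum of two squares
  have key : ∀ q r : ℝ[X], p = q * r → q.natDegree = 2 → (∀ x, 0 ≤ r.eval x) →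
      (∃ c d : ℝ[X], q = c ^ 2 + d ^ 2) → ∃ a b : ℝ[X], p = a ^ 2 + b ^ 2 := by
    rintro q r h hq hr ⟨c, d, hcd⟩
    have hq0 : q ≠ 0 := by rintro rfl; simp at hq
    have hr0 : r ≠ 0 := by rintro rfl; simp [h] at hp0
    have hdeg : p.natDegree = 2 + r.natDegree := by rw [h, natDegree_mul hq0 hr0, hq]
    obtain ⟨a, b, hab⟩ := ih r.natDegree (by omega) r le_rfl hr
    exact ⟨c * a - d * b, c * b + d * a, by rw [h, hcd, hab]; ring⟩
  obtain ⟨z, hz⟩ : ∃ z : ℂ, aeval z p = 0 := by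
    apply IsAlgClosed.exists_aeval_eq_zero ℂ p
    intro h
    exact hd (natDegree_eq_of_degree_eq_some h)
  by_cases him : z.im = 0
  · set t := z.re with ht
    have hzt : z = algebraMap ℝ ℂ t := by apply Complex.ext <;> simp [ht, him]
    have hroot : p.IsRoot t := by
      rw [hzt, aeval_algebraMap_apply] at hz
      simpa using hz
    obtain ⟨q, hq⟩ := dvd_iff_isRoot.mpr hroot
    have hev : ∀ x, p.eval x = (x - t) * q.eval x := fun x => by rw [hq]; simp
    have hqt : q.eval t = 0 := by
      have h1 : Filter.Tendsto (fun x => q.eval x) (nhdsWithin t (Set.Ioi t)) (nhds (q.eval t)) :=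
        (q.continuous.tendsto t).mono_left nhdsWithin_le_nhds
      have h2 : Filter.Tendsto (fun x => q.eval x) (nhdsWithin t (Set.Iio t)) (nhds (q.eval t)) :=
        (q.continuous.tendsto t).mono_left nhdsWithin_le_nhds
      apply le_antisymm
      · refine le_of_tendsto h2 ?_
        filter_upwards [self_mem_nhdsWithin] with x hx
        have := hp x
        rw [hev] at this
        simp only [Set.mem_Iio] at hx
        nlinarith
      · refine ge_of_tendsto h1 ?_
        filter_upwards [self_mem_nhdsWithin] with x hx
        have := hp x
        rw [hev] at this
        simp only [Set.mem_Ioi] at hx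
        nlinarith
    obtain ⟨r, hr⟩ := dvd_iff_isRoot.mpr (show q.IsRoot t from hqt)
    have hev2 : ∀ x, p.eval x = (x - t) ^ 2 * r.eval x := fun x => by
      rw [hq, hr]; simp; ring
    have hoff : ∀ x, x ≠ t → 0 ≤ r.eval x := fun x hx => by
      have := hp x
      rw [hev2] at this
      have h3 : 0 < (x - t) ^ 2 := by
        have : x - t ≠ 0 := sub_ne_zero.mpr hx
        positivity
      exact nonneg_of_mul_nonneg_right this h3
    refine key ((X - C t) ^ 2) r (by rw [hq, hr]; ring) (by simp) ?_ ⟨X - C t, 0, by ring⟩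
    intro x
    by_cases hx : x = t
    · subst hx
      have h1 : Filter.Tendsto (fun y => r.eval y) (nhdsWithin t (Set.Ioi t)) (nhds (r.eval t)) :=
        (r.continuous.tendsto t).mono_left nhdsWithin_le_nhds
      refine ge_of_tendsto h1 ?_
      filter_upwards [self_mem_nhdsWithin] with y hy
      exact hoff y (ne_of_gt hy)
    · exact hoff x hx
  · obtain ⟨r, hr⟩ := p.quadratic_dvd_of_aeval_eq_zero_im_ne_zero hz him
    have hquad : (X ^ 2 - C (2 * z.re) * X + C (‖z‖ ^ 2) : ℝ[X]) = (X - C z.re) ^ 2 + (C z.im) ^ 2 := by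
      have : ‖z‖ ^ 2 = z.re ^ 2 + z.im ^ 2 := by
        rw [Complex.sq_norm, Complex.normSq_apply]; ring
      rw [this]
      simp only [C_add, C_mul, C_pow, map_ofNat]
      ring
    refine key _ r hr ?_ ?_ ⟨_, _, hquad⟩
    · compute_degree!
    · intro x
      have := hp x
      rw [hr, hquad] at this
      simp only [eval_mul, eval_add, eval_pow, eval_sub, eval_X, eval_C] at this
      exact nonneg_of_mul_nonneg_right this (by positivity)

open scoped CompactlySupported in
open Polynomial in
lemma ext_aux (M : ℝ[X] →ₗ[ℝ] ℝ) (hM : ∀ p : ℝ[X], (∀ x, 0 ≤ p.eval x) → 0 ≤ M p) :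
    ∃ L : C_c(ℝ, ℝ) →ₗ[ℝ] ℝ, ∀ (p : ℝ[X]) (f : C_c(ℝ, ℝ)),
      (∀ x, 0 ≤ p.eval x + f x) → 0 ≤ M p + L f := by
  let s : PointedCone ℝ (ℝ[X] × C_c(ℝ, ℝ)) :=
    { carrier := {u | ∀ x, 0 ≤ u.1.eval x + u.2 x}
      add_mem' := by
        intro a b ha hb x
        have := ha x
        have := hb x
        simp only [Prod.fst_add, Prod.snd_add, eval_add, CompactlySupportedContinuousMap.coe_add,
          Pi.add_apply]
        linarith
      zero_mem' := by intro x; simp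
      smul_mem' := by
        intro c a ha x
        have h := mul_nonneg c.2 (ha x)
        have e1 : (c • a).1 = (c : ℝ) • a.1 := rfl
        have e2 : (c • a).2 = (c : ℝ) • a.2 := rfl
        rw [e1, e2]
        simp only [eval_smul, CompactlySupportedContinuousMap.coe_smul, Pi.smul_apply, smul_eq_mul]
        linarith }
  let D : Submodule ℝ (ℝ[X] × C_c(ℝ, ℝ)) := Submodule.prod ⊤ ⊥
  let F : (ℝ[X] × C_c(ℝ, ℝ)) →ₗ.[ℝ] ℝ :=
    ⟨D, (M ∘ₗ LinearMap.fst ℝ _ _) ∘ₗ D.subtype⟩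
  obtain ⟨g, hg1, hg2⟩ := riesz_extension s F (by
      rintro ⟨⟨p, f⟩, hx⟩ hs
      have hf : f = 0 := (Submodule.mem_prod.mp hx).2
      subst hf
      apply hM p
      intro x
      simpa using hs x) (by
      rintro ⟨p, f⟩
      obtain ⟨K, hK⟩ := f.hasCompactSupport.exists_bound_of_continuous f.continuous
      refine ⟨⟨(-p + C K, 0), Submodule.mem_prod.mpr ⟨trivial, Submodule.zero_mem _⟩⟩, ?_⟩
      intro x
      have := neg_le_of_abs_le (hK x)
      simp only [Prod.fst_add, Prod.snd_add, eval_add, eval_neg, eval_C, zero_add]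
      linarith)
  refine ⟨g ∘ₗ LinearMap.inr ℝ _ _, fun p f h => ?_⟩
  have h1 := hg2 (p, f) h
  have h2 : g (p, 0) = M p :=
    hg1 ⟨(p, 0), Submodule.mem_prod.mpr ⟨trivial, Submodule.zero_mem _⟩⟩
  have h3 : ((p, f) : ℝ[X] × C_c(ℝ, ℝ)) = (p, 0) + (0, f) := by simp
  rw [h3, map_add, h2] at h1
  exact h1

open scoped CompactlySupported in
open Polynomial in
lemma haviland (M : ℝ[X] →ₗ[ℝ] ℝ) (hM : ∀ p : ℝ[X], (∀ x, 0 ≤ p.eval x) → 0 ≤ M p) :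
    ∃ ρ : Measure ℝ, (∀ p : ℝ[X], Integrable (fun x => p.eval x) ρ) ∧
      ∀ p : ℝ[X], ∫ x, p.eval x ∂ρ = M p := by
  obtain ⟨L, hL⟩ := ext_aux M hM
  let Λ : C_c(ℝ, ℝ) →ₚ[ℝ] ℝ := PositiveLinearMap.mk₀ L (fun f hf => by
    have := hL 0 f (fun x => by simpa using hf x)
    simpa using this)
  let ρ := RealRMK.rieszMeasure Λ
  have hρ : ∀ f : C_c(ℝ, ℝ), ∫ x, f x ∂ρ = L f := RealRMK.integral_rieszMeasure Λ
  -- cutoffs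
  let χ : ℕ → ℝ → ℝ := fun n x => max 0 (1 - x ^ 2 / ((n : ℝ) + 1) ^ 2)
  have hχc : ∀ n, Continuous (χ n) := fun n => by fun_prop
  have hχs : ∀ (n : ℕ) (x : ℝ), x ∉ Metric.closedBall (0 : ℝ) (n + 1) → χ n x = 0 := by
    intro n x hx
    rw [mem_closedBall_zero_iff, Real.norm_eq_abs, not_le] at hx
    have h1 : ((n : ℝ) + 1) ^ 2 ≤ x ^ 2 := by
      rw [← sq_abs x]; gcongr
    have h2 : 1 ≤ x ^ 2 / ((n : ℝ) + 1) ^ 2 := by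
      rw [le_div_iff₀ (by positivity)]; simpa using h1
    exact max_eq_left (by linarith)
  let cut : ℝ[X] → ℕ → C_c(ℝ, ℝ) := fun p n =>
    ⟨⟨fun x => p.eval x * χ n x, p.continuous.mul (hχc n)⟩,
      HasCompactSupport.intro (isCompact_closedBall (0 : ℝ) (n + 1)) (fun x hx => by
        simp [hχs n x hx])⟩
  have hcut : ∀ p n x, cut p n x = p.eval x * χ n x := fun _ _ _ => rfl
  have hχ0 : ∀ n x, 0 ≤ χ n x := fun n x => le_max_left _ _
  have hχ1 : ∀ n x, χ n x ≤ 1 := fun n x => max_le zero_le_one (by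
    have : 0 ≤ x ^ 2 / ((n : ℝ) + 1) ^ 2 := by positivity
    linarith)
  have hχ2 : ∀ (n : ℕ) (x : ℝ), 1 - x ^ 2 / ((n : ℝ) + 1) ^ 2 ≤ χ n x := fun n x => le_max_right _ _
  have hlim0 : Filter.Tendsto (fun n : ℕ => 1 / ((n : ℝ) + 1) ^ 2) Filter.atTop (nhds 0) := by
    have := (tendsto_one_div_add_atTop_nhds_zero_nat (𝕜 := ℝ)).pow 2
    simpa using this
  have hχlim : ∀ x, Filter.Tendsto (fun n => χ n x) Filter.atTop (nhds 1) := by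
    intro x
    refine tendsto_of_tendsto_of_tendsto_of_le_of_le ?_ tendsto_const_nhds
      (fun n => hχ2 n x) (fun n => hχ1 n x)
    have := (hlim0.const_mul (x ^ 2)).const_sub 1
    simpa [div_eq_mul_inv] using this
  have hpos : ∀ p : ℝ[X], (∀ x, 0 ≤ p.eval x) →
      Integrable (fun x => p.eval x) ρ ∧ ∫ x, p.eval x ∂ρ = M p := by
    intro p hp
    have hup : ∀ n, L (cut p n) ≤ M p := by
      intro n
      have := hL p (-(cut p n)) (fun x => by
        rw [CompactlySupportedContinuousMap.coe_neg, Pi.neg_apply, hcut]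
        nlinarith [hp x, hχ1 n x])
      rw [map_neg] at this
      linarith
    have hlow : ∀ n : ℕ, M p - 1 / ((n : ℝ) + 1) ^ 2 * M (p * X ^ 2) ≤ L (cut p n) := by
      intro n
      have := hL (-p + (1 / ((n : ℝ) + 1) ^ 2) • (p * X ^ 2)) (cut p n) (fun x => by
        rw [hcut]
        simp only [eval_add, eval_neg, eval_smul, eval_mul, eval_pow, eval_X, smul_eq_mul]
        have := mul_le_mul_of_nonneg_left (hχ2 n x) (hp x)
        have e : p.eval x * (1 - x ^ 2 / ((n : ℝ) + 1) ^ 2) =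
          p.eval x - 1 / ((n : ℝ) + 1) ^ 2 * (p.eval x * x ^ 2) := by ring
        linarith)
      rw [map_add, map_neg, map_smul, smul_eq_mul] at this
      linarith
    have hcint : ∀ n, Integrable (fun x => p.eval x * χ n x) ρ := fun n =>
      (cut p n).continuous.integrable_of_hasCompactSupport (cut p n).hasCompactSupport
    have hcval : ∀ n, ∫ x, p.eval x * χ n x ∂ρ = L (cut p n) := fun n => hρ (cut p n)
    have hfat : ∫⁻ x, ENNReal.ofReal (p.eval x) ∂ρ ≤ ENNReal.ofReal (M p) := by
      have h1 : ∀ x, Filter.liminf (fun n => ENNReal.ofReal (p.eval x * χ n x)) Filter.atTop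
          = ENNReal.ofReal (p.eval x) := by
        intro x
        apply Filter.Tendsto.liminf_eq
        apply ENNReal.tendsto_ofReal
        simpa using (hχlim x).const_mul (p.eval x)
      simp_rw [← h1]
      refine (lintegral_liminf_le (fun n => ?_)).trans ?_
      · exact ((p.continuous.mul (hχc n)).measurable).ennreal_ofReal
      · refine Filter.liminf_le_of_le (by isBoundedDefault) ?_
        intro b hb
        obtain ⟨n, hn⟩ := hb.exists
        refine hn.trans ?_
        rw [← ofReal_integral_eq_lintegral_ofReal (hcint n)
          (Filter.Eventually.of_forall fun x => mul_nonneg (hp x) (hχ0 n x)), hcval]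
        exact ENNReal.ofReal_le_ofReal (hup n)
    have hint : Integrable (fun x => p.eval x) ρ := by
      refine ⟨p.continuous.aestronglyMeasurable, ?_⟩
      rw [hasFiniteIntegral_iff_ofReal (Filter.Eventually.of_forall hp)]
      exact hfat.trans_lt ENNReal.ofReal_lt_top
    refine ⟨hint, le_antisymm ?_ ?_⟩
    · rw [← ENNReal.ofReal_le_ofReal_iff (hM p hp),
        ofReal_integral_eq_lintegral_ofReal hint (Filter.Eventually.of_forall hp)]
      exact hfat
    · have h1 : ∀ n : ℕ, M p - 1 / ((n : ℝ) + 1) ^ 2 * M (p * X ^ 2) ≤ ∫ x, p.eval x ∂ρ := by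
        intro n
        refine (hlow n).trans ?_
        rw [← hcval]
        exact integral_mono (hcint n) hint (fun x => by
          have := mul_le_mul_of_nonneg_left (hχ1 n x) (hp x)
          simpa using this)
      have h2 : Filter.Tendsto (fun n : ℕ => M p - 1 / ((n : ℝ) + 1) ^ 2 * M (p * X ^ 2))
          Filter.atTop (nhds (M p)) := by
        simpa using (hlim0.mul_const (M (p * X ^ 2))).const_sub (M p)
      exact le_of_tendsto h2 (Filter.Eventually.of_forall h1)
  have hgen : ∀ p : ℝ[X], Integrable (fun x => p.eval x) ρ ∧ ∫ x, p.eval x ∂ρ = M p := by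
    intro p
    obtain ⟨i1, e1⟩ := hpos (p + (1 + p ^ 2)) (fun x => by
      simp only [eval_add, eval_one, eval_pow]; nlinarith [sq_nonneg (p.eval x + 1)])
    obtain ⟨i2, e2⟩ := hpos (1 + p ^ 2) (fun x => by
      simp only [eval_add, eval_one, eval_pow]; positivity)
    have e : (fun x => p.eval x) = fun x => (p + (1 + p ^ 2)).eval x - (1 + p ^ 2).eval x := by
      ext x; simp
    rw [e]
    refine ⟨i1.sub i2, ?_⟩
    rw [integral_sub i1 i2, e1, e2, map_add]
    ring
  exact ⟨ρ, fun p => (hgen p).1, fun p => (hgen p).2⟩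

lemma finite_of_one {X : Type*} [MeasurableSpace X] {ρ : Measure X}
    (h : Integrable (fun _ : X => (1 : ℝ)) ρ) : IsFiniteMeasure ρ := by
  rcases integrable_const_iff.mp h with h | h
  · exact absurd h one_ne_zero
  · exact h

lemma radon_of_finite (ρ : Measure ℝ) [IsFiniteMeasure ρ] : IsRadon ρ :=
  ⟨inferInstance, inferInstance⟩

open Polynomial in
lemma int_div {τ : Measure ℝ} (hi : ∀ p : ℝ[X], Integrable (fun x => p.eval x) τ) (p : ℝ[X]) :
    Integrable (fun x => p.eval x / (1 + x ^ 2)) τ := by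
  refine (hi p).mono ?_ (Filter.Eventually.of_forall fun x => ?_)
  · exact (Continuous.div p.continuous (by fun_prop)
      (fun x => by positivity)).aestronglyMeasurable
  · rw [norm_div]
    refine div_le_self (norm_nonneg _) ?_
    rw [Real.norm_eq_abs, abs_of_pos (by positivity)]
    nlinarith [sq_nonneg x]

open Polynomial in
lemma riesz_key (τ : Measure ℝ) (hi : ∀ p : ℝ[X], Integrable (fun x => p.eval x) τ)
    (hdet : Determinate1D τ) (δ : ℝ) (hδ : 0 < δ) :
    ∃ a : ℝ[X], ∫ x, (a ^ 2).eval x / (1 + x ^ 2) ∂τ < δ * ‖aeval Complex.I a‖ ^ 2 := by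
  by_contra! hcon
  let M : ℝ[X] →ₗ[ℝ] ℝ :=
    { toFun := fun p => ∫ x, p.eval x / (1 + x ^ 2) ∂τ - δ * (aeval Complex.I p).re
      map_add' := fun p q => by
        have : ∀ x, (p + q).eval x / (1 + x ^ 2) =
          p.eval x / (1 + x ^ 2) + q.eval x / (1 + x ^ 2) := fun x => by rw [eval_add, add_div]
        simp_rw [this]
        rw [integral_add (int_div hi p) (int_div hi q), map_add, Complex.add_re]
        ring
      map_smul' := fun c p => by
        have : ∀ x, (c • p).eval x / (1 + x ^ 2) =
          c * (p.eval x / (1 + x ^ 2)) := fun x => by rw [eval_smul, smul_eq_mul, mul_div_assoc]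
        simp_rw [this]
        rw [integral_const_mul, map_smul, Complex.smul_re]
        simp only [smul_eq_mul, RingHom.id_apply]
        ring }
  have hMdef : ∀ p, M p = ∫ x, p.eval x / (1 + x ^ 2) ∂τ - δ * (aeval Complex.I p).re :=
    fun _ => rfl
  have hsq : ∀ a : ℝ[X], 0 ≤ M (a ^ 2) := fun a => by
    rw [hMdef]
    have h1 := hcon a
    have h2 : (aeval Complex.I (a ^ 2)).re ≤ ‖aeval Complex.I a‖ ^ 2 := by
      refine (Complex.re_le_norm _).trans ?_
      rw [map_pow, norm_pow]
    nlinarith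
  obtain ⟨ρ', hρi, hρe⟩ := haviland M (fun p hp => by
    obtain ⟨a, b, rfl⟩ := sos_aux p.natDegree p le_rfl hp
    rw [map_add]
    exact add_nonneg (hsq a) (hsq b))
  let w : ℝ → NNReal := fun x => ⟨1 + x ^ 2, by positivity⟩
  have hwv : ∀ x, ((w x : NNReal) : ℝ) = 1 + x ^ 2 := fun _ => rfl
  have hw : Measurable w := by
    apply Measurable.subtype_mk
    fun_prop
  let ρ : Measure ℝ := ρ'.withDensity (fun x => w x)
  have hwm : ∀ (n : ℕ) (x : ℝ), w x • x ^ n = (X ^ n * (1 + X ^ 2) : ℝ[X]).eval x := by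
    intro n x
    rw [NNReal.smul_def]
    rw [hwv]
    simp only [eval_mul, eval_pow, eval_X, eval_add, eval_one, smul_eq_mul]; ring
  have hint : ∀ n : ℕ, Integrable (fun y : ℝ => y ^ n) ρ := by
    intro n
    rw [integrable_withDensity_iff_integrable_smul hw]
    simp_rw [hwm]
    exact hρi _
  have heq : ρ = τ := by
    have : IsFiniteMeasure ρ := finite_of_one (by simpa using hint 0)
    refine hdet ρ (radon_of_finite ρ) hint (fun n => ?_)
    rw [integral_withDensity_eq_integral_smul hw]
    simp_rw [hwm]
    rw [hρe, hMdef]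
    have : aeval Complex.I (X ^ n * (1 + X ^ 2) : ℝ[X]) = 0 := by simp
    rw [this]
    simp only [Complex.zero_re, mul_zero, sub_zero]
    congr 1
    ext x
    have : (1 + x ^ 2) ≠ 0 := by positivity
    simp only [eval_mul, eval_pow, eval_X, eval_add, eval_one]
    field_simp
  have h1 : ∫ x, (1 + x ^ 2)⁻¹ ∂τ = M 1 := by
    rw [← heq, integral_withDensity_eq_integral_smul hw, ← hρe]
    congr 1
    ext x
    have : (1 + x ^ 2) ≠ 0 := by positivity
    rw [NNReal.smul_def, hwv, smul_eq_mul, mul_inv_cancel₀ this, eval_one]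
  rw [hMdef] at h1
  simp at h1
  linarith

open Polynomial in
lemma approx (τ : Measure ℝ) (hi : ∀ p : ℝ[X], Integrable (fun x => p.eval x) τ)
    (hdet : Determinate1D τ) (δ : ℝ) (hδ : 0 < δ) :
    (∃ q : ℝ[X], ∫ x, (1 / (1 + x ^ 2) - q.eval x) ^ 2 ∂τ < δ) ∧
    (∃ q : ℝ[X], ∫ x, (x / (1 + x ^ 2) - q.eval x) ^ 2 ∂τ < δ) := by
  obtain ⟨a, ha⟩ := riesz_key τ hi hdet δ hδ
  have hmon : (X ^ 2 + 1 : ℝ[X]).Monic := by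
    have := monic_X_pow_add_C (1 : ℝ) (two_ne_zero)
    simpa using this
  have hdeg : (a %ₘ (X ^ 2 + 1)).degree ≤ 1 := by
    have h1 := degree_modByMonic_lt a hmon
    have h2 : (X ^ 2 + 1 : ℝ[X]).degree = 2 := by compute_degree!
    rw [h2] at h1
    exact Order.le_of_lt_succ h1
  obtain ⟨q, α, β, hq⟩ : ∃ (q : ℝ[X]) (α β : ℝ), a = C α + C β * X + (X ^ 2 + 1) * q := by
    refine ⟨a /ₘ (X ^ 2 + 1), (a %ₘ (X ^ 2 + 1)).coeff 0, (a %ₘ (X ^ 2 + 1)).coeff 1, ?_⟩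
    have h1 := modByMonic_add_div a (X ^ 2 + 1)
    have h2 := eq_X_add_C_of_degree_le_one hdeg
    rw [h2] at h1
    rw [add_comm (C _) (C _ * X)]
    exact h1.symm
  set N := α ^ 2 + β ^ 2 with hN
  have hnorm : ‖aeval Complex.I a‖ ^ 2 = N := by
    rw [hq, Complex.sq_norm, Complex.normSq_apply]
    simp [hN]
    ring
  rw [hnorm] at ha
  have hnn : 0 ≤ ∫ x, (a ^ 2).eval x / (1 + x ^ 2) ∂τ := by
    apply integral_nonneg
    intro x
    simp only [eval_pow, Pi.zero_apply]
    positivity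
  have hNpos : 0 < N := by
    by_contra h
    have : N = 0 := le_antisymm (not_lt.mp h) (by positivity)
    rw [this] at ha
    linarith
  have hae : ∀ x, a.eval x = α + β * x + (x ^ 2 + 1) * q.eval x := fun x => by rw [hq]; simp
  -- generic step
  have key : ∀ (F : ℝ → ℝ), (∀ x, F x ^ 2 ≤ (a ^ 2).eval x / (1 + x ^ 2) / N) →
      ∫ x, F x ^ 2 ∂τ < δ := by
    intro F hF
    have h1 : ∫ x, F x ^ 2 ∂τ ≤ ∫ x, (a ^ 2).eval x / (1 + x ^ 2) / N ∂τ :=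
      integral_mono_of_nonneg (Filter.Eventually.of_forall fun x => sq_nonneg _)
        ((int_div hi _).div_const N) (Filter.Eventually.of_forall hF)
    refine h1.trans_lt ?_
    rw [integral_div, div_lt_iff₀ hNpos]
    exact ha
  have key2 : ∀ x c : ℝ, c ^ 2 ≤ N * (1 + x ^ 2) →
      (c * a.eval x / (N * (1 + x ^ 2))) ^ 2 ≤ (a ^ 2).eval x / (1 + x ^ 2) / N := by
    intro x c hc
    have e : (a ^ 2).eval x / (1 + x ^ 2) / N =
      (N * (1 + x ^ 2)) * (a.eval x) ^ 2 / (N * (1 + x ^ 2)) ^ 2 := by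
      rw [eval_pow]; field_simp
    rw [e, div_pow, mul_pow]
    gcongr
  constructor
  · refine ⟨C (β ^ 2 / N) - C (1 / N) * (C α - C β * X) * q, key _ fun x => ?_⟩
    have := key2 x (α - β * x) (by rw [hN]; nlinarith [sq_nonneg (α * x + β)])
    convert this using 2
    rw [hae]
    simp only [eval_sub, eval_mul, eval_C, eval_X]
    field_simp
    rw [hN]; ring
  · refine ⟨-C (α * β / N) - C (1 / N) * (C β + C α * X) * q, key _ fun x => ?_⟩
    have := key2 x (β + α * x) (by rw [hN]; nlinarith [sq_nonneg (β * x - α)])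
    convert this using 2
    rw [hae]
    simp only [eval_sub, eval_neg, eval_add, eval_mul, eval_C, eval_X]
    field_simp
    rw [hN]; ring

/-- Functions `G` such that `P * G` is square integrable for both measures with the same integral,
for all polynomials `P`. -/
def Good {d : ℕ} (μ ν : Measure (Fin d → ℝ)) (G : (Fin d → ℝ) → ℝ) : Prop :=
  ∀ P : MvPolynomial (Fin d) ℝ,
    MemLp (fun x => MvPolynomial.eval x P * G x) 2 μ ∧
    MemLp (fun x => MvPolynomial.eval x P * G x) 2 ν ∧
    ∫ x, MvPolynomial.eval x P * G x ∂ν = ∫ x, MvPolynomial.eval x P * G x ∂μ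

lemma abs_int_le {X : Type*} [MeasurableSpace X] {μ : Measure X} {f g : X → ℝ}
    (hf : MemLp f 2 μ) (hg : MemLp g 2 μ) {η : ℝ} (hη : 0 < η)
    (h : ∫ x, f x ^ 2 ∂μ < η ^ 2) :
    |∫ x, f x * g x ∂μ| ≤ η * (1 + ∫ x, g x ^ 2 ∂μ) := by
  have h1 : |∫ x, f x * g x ∂μ| ≤ ∫ x, (η⁻¹ * f x ^ 2 + η * g x ^ 2) ∂μ := by
    rw [← Real.norm_eq_abs]
    refine norm_integral_le_of_norm_le ((hf.integrable_sq.const_mul _).add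
      (hg.integrable_sq.const_mul _)) (Filter.Eventually.of_forall fun x => ?_)
    rw [Real.norm_eq_abs]
    have h2 : η⁻¹ * f x ^ 2 + η * g x ^ 2 - |f x * g x| =
        η⁻¹ * ((|f x| - η * |g x| / 2) ^ 2 + 3 / 4 * (η * |g x|) ^ 2) := by
      rw [abs_mul, ← sq_abs (f x), ← sq_abs (g x)]
      field_simp
      ring
    have h3 : 0 ≤ η⁻¹ * ((|f x| - η * |g x| / 2) ^ 2 + 3 / 4 * (η * |g x|) ^ 2) := by positivity
    linarith
  rw [integral_add (hf.integrable_sq.const_mul _) (hg.integrable_sq.const_mul _),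
    integral_const_mul, integral_const_mul] at h1
  have h4 : η⁻¹ * ∫ x, f x ^ 2 ∂μ ≤ η := by
    rw [inv_mul_le_iff₀ hη]; nlinarith
  linarith

lemma memLp_bdd_mul {d : ℕ} {μ : Measure (Fin d → ℝ)} {j : Fin d} {φ : ℝ → ℝ} (hφ : Continuous φ)
    (hb : ∀ y, |φ y| ≤ 1) {G : (Fin d → ℝ) → ℝ} (hG : MemLp G 2 μ) :
    MemLp (fun x => φ (x j) * G x) 2 μ := by
  refine hG.mono ((hφ.comp (continuous_apply j)).aestronglyMeasurable.mul hG.1)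
    (Filter.Eventually.of_forall fun x => ?_)
  rw [norm_mul]
  exact mul_le_of_le_one_left (norm_nonneg _) (hb _)

lemma eval_aeval {d : ℕ} (j : Fin d) (q : Polynomial ℝ) (x : Fin d → ℝ) :
    MvPolynomial.eval x (Polynomial.aeval (MvPolynomial.X j) q) = q.eval (x j) := by
  induction q using Polynomial.induction_on' with
  | add p q hp hq => simp [hp, hq]
  | monomial n a => simp [Polynomial.aeval_monomial]

lemma memLp_poly {d : ℕ} {μ : Measure (Fin d → ℝ)}
    (hint : ∀ p : MvPolynomial (Fin d) ℝ, Integrable (fun x => MvPolynomial.eval x p) μ)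
    (p : MvPolynomial (Fin d) ℝ) : MemLp (fun x => MvPolynomial.eval x p) 2 μ := by
  rw [memLp_two_iff_integrable_sq (hint p).1]
  have e : (fun x => MvPolynomial.eval x p ^ 2) = fun x => MvPolynomial.eval x (p ^ 2) := by
    funext x
    rw [map_pow]
  rw [e]
  exact hint (p ^ 2)

lemma good_mul {d : ℕ} {μ ν : Measure (Fin d → ℝ)}
    (hμ : ∀ p : MvPolynomial (Fin d) ℝ, Integrable (fun x => MvPolynomial.eval x p) μ)
    (hν : ∀ p : MvPolynomial (Fin d) ℝ, Integrable (fun x => MvPolynomial.eval x p) ν)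
    (j : Fin d) (hmap : Measure.map (fun x : Fin d → ℝ => x j) ν =
      Measure.map (fun x : Fin d → ℝ => x j) μ)
    {φ : ℝ → ℝ} (hφ : Continuous φ) (hb : ∀ y, |φ y| ≤ 1)
    (happ : ∀ δ > 0, ∃ q : Polynomial ℝ,
      ∫ y, (φ y - q.eval y) ^ 2 ∂(Measure.map (fun x : Fin d → ℝ => x j) μ) < δ)
    {G : (Fin d → ℝ) → ℝ} (hG : Good μ ν G) : Good μ ν (fun x => φ (x j) * G x) := by
  intro P
  obtain ⟨h1, h2, -⟩ := hG P
  have e : (fun x => MvPolynomial.eval x P * (φ (x j) * G x)) =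
    fun x => φ (x j) * (MvPolynomial.eval x P * G x) := by ext x; ring
  rw [e]
  refine ⟨memLp_bdd_mul hφ hb h1, memLp_bdd_mul hφ hb h2, ?_⟩
  set H : (Fin d → ℝ) → ℝ := fun x => MvPolynomial.eval x P * G x with hH
  set B := 2 + ∫ x, H x ^ 2 ∂μ + ∫ x, H x ^ 2 ∂ν with hB
  have hBpos : 0 < B := by
    have a1 : 0 ≤ ∫ x, H x ^ 2 ∂μ := integral_nonneg fun x => sq_nonneg _
    have a2 : 0 ≤ ∫ x, H x ^ 2 ∂ν := integral_nonneg fun x => sq_nonneg _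
    linarith
  have main : ∀ η > 0, |∫ x, φ (x j) * H x ∂ν - ∫ x, φ (x j) * H x ∂μ| ≤ η * B := by
    intro η hη
    obtain ⟨q, hq⟩ := happ (η ^ 2) (by positivity)
    have hmeas : Measurable (fun x : Fin d → ℝ => x j) := measurable_pi_apply j
    have hcq : Continuous fun y => (φ y - q.eval y) ^ 2 := (hφ.sub q.continuous).pow 2
    have step : ∀ κ : Measure (Fin d → ℝ), 
        (∀ p : MvPolynomial (Fin d) ℝ, Integrable (fun x => MvPolynomial.eval x p) κ) →
        Measure.map (fun x : Fin d → ℝ => x j) κ = Measure.map (fun x : Fin d → ℝ => x j) μ →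
        MemLp H 2 κ →
        MemLp (fun x => q.eval (x j) * H x) 2 κ →
        |∫ x, φ (x j) * H x ∂κ - ∫ x, q.eval (x j) * H x ∂κ| ≤ η * (1 + ∫ x, H x ^ 2 ∂κ) := by
      intro κ hκ hm hHκ hqH
      have : IsFiniteMeasure κ := finite_of_one (by simpa using hκ 1)
      have l1 : MemLp (fun x : Fin d → ℝ => q.eval (x j)) 2 κ := by
        simpa only [eval_aeval] using memLp_poly hκ (Polynomial.aeval (MvPolynomial.X j) q)
      have l2 : MemLp (fun x : Fin d → ℝ => φ (x j)) 2 κ := by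
        simpa using memLp_bdd_mul (j := j) hφ hb (memLp_const (μ := κ) (p := 2) (1 : ℝ))
      have l3 : MemLp (fun x : Fin d → ℝ => φ (x j) - q.eval (x j)) 2 κ := l2.sub l1
      have l4 : ∫ x, (φ (x j) - q.eval (x j)) ^ 2 ∂κ < η ^ 2 := by
        rw [← hm, integral_map hmeas.aemeasurable hcq.aestronglyMeasurable] at hq
        exact hq
      have := abs_int_le l3 hHκ hη l4
      have i1 : Integrable (fun x => φ (x j) * H x) κ := l2.integrable_mul hHκ
      have i2 : Integrable (fun x => q.eval (x j) * H x) κ := l1.integrable_mul hHκ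
      rw [← integral_sub i1 i2]
      simpa only [sub_mul] using this
    have eqq : (fun x => MvPolynomial.eval x (Polynomial.aeval (MvPolynomial.X j) q * P) * G x)
        = fun x => q.eval (x j) * H x := by
      ext x; rw [map_mul, eval_aeval, hH]; ring
    obtain ⟨g1, g2, g3⟩ := hG (Polynomial.aeval (MvPolynomial.X j) q * P)
    rw [eqq] at g1 g2 g3
    have s1 := abs_le.mp (step μ hμ rfl h1 g1)
    have s2 := abs_le.mp (step ν hν hmap h2 g2)
    rw [g3] at s2
    rw [abs_le, hB]
    constructor <;> linarith [s1.1, s1.2, s2.1, s2.2]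
  by_contra hne
  have hpos : 0 < |∫ x, φ (x j) * H x ∂ν - ∫ x, φ (x j) * H x ∂μ| :=
    abs_pos.mpr (sub_ne_zero.mpr hne)
  have := main (|∫ x, φ (x j) * H x ∂ν - ∫ x, φ (x j) * H x ∂μ| / (2 * B)) (by positivity)
  have e2 : |∫ x, φ (x j) * H x ∂ν - ∫ x, φ (x j) * H x ∂μ| / (2 * B) * B
    = |∫ x, φ (x j) * H x ∂ν - ∫ x, φ (x j) * H x ∂μ| / 2 := by field_simp
  linarith

lemma good_add {d : ℕ} {μ ν : Measure (Fin d → ℝ)} [IsFiniteMeasure μ] [IsFiniteMeasure ν]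
    {G H : (Fin d → ℝ) → ℝ} (hG : Good μ ν G)
    (hH : Good μ ν H) : Good μ ν (fun x => G x + H x) := by
  intro P
  obtain ⟨a1, a2, a3⟩ := hG P
  obtain ⟨b1, b2, b3⟩ := hH P
  simp only [mul_add]
  refine ⟨a1.add b1, a2.add b2, ?_⟩
  rw [integral_add (a1.integrable one_le_two) (b1.integrable one_le_two),
    integral_add (a2.integrable one_le_two) (b2.integrable one_le_two), a3, b3]

lemma good_smul {d : ℕ} {μ ν : Measure (Fin d → ℝ)}
    {G : (Fin d → ℝ) → ℝ} (c : ℝ) (hG : Good μ ν G) : Good μ ν (fun x => c * G x) := by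
  intro P
  obtain ⟨a1, a2, a3⟩ := hG P
  have e : (fun x => MvPolynomial.eval x P * (c * G x)) =
    fun x => c * (MvPolynomial.eval x P * G x) := by ext x; ring
  rw [e]
  refine ⟨a1.const_mul c, a2.const_mul c, ?_⟩
  rw [integral_const_mul, integral_const_mul, a3]

lemma poly_eq {d : ℕ} {μ ν : Measure (Fin d → ℝ)}
    (hμ : ∀ p : MvPolynomial (Fin d) ℝ, Integrable (fun x => MvPolynomial.eval x p) μ)
    (hν : ∀ p : MvPolynomial (Fin d) ℝ, Integrable (fun x => MvPolynomial.eval x p) ν)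
    (h : ∀ α : Fin d → ℕ,
        ∫ x : Fin d → ℝ, ∏ i, x i ^ α i ∂ν = ∫ x : Fin d → ℝ, ∏ i, x i ^ α i ∂μ)
    (p : MvPolynomial (Fin d) ℝ) :
    ∫ x, MvPolynomial.eval x p ∂ν = ∫ x, MvPolynomial.eval x p ∂μ := by
  induction p using MvPolynomial.induction_on' with
  | monomial u a =>
    have e : ∀ x : Fin d → ℝ, MvPolynomial.eval x (MvPolynomial.monomial u a) =
        a * ∏ i, x i ^ u i := by
      intro x
      rw [MvPolynomial.eval_monomial, Finsupp.prod_fintype _ _ (by simp)]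
    simp_rw [e]
    rw [integral_const_mul, integral_const_mul, h]
  | add p q hp hq =>
    simp only [map_add]
    rw [integral_add (hμ p) (hμ q), integral_add (hν p) (hν q), hp, hq]

/-- Petersen's theorem: if all marginal measures of `μ` are determinate, so is `μ`. -/
theorem petersen (d : ℕ) (μ : Measure (Fin d → ℝ)) (hμ : IsRadon μ)
    (hint : ∀ p : MvPolynomial (Fin d) ℝ, Integrable (fun x => MvPolynomial.eval x p) μ)
    (hmarg : ∀ j : Fin d, Determinate1D (Measure.map (fun x : Fin d → ℝ => x j) μ)) :
    ∀ ν : Measure (Fin d → ℝ), IsRadon ν →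
      (∀ p : MvPolynomial (Fin d) ℝ, Integrable (fun x => MvPolynomial.eval x p) ν) →
      (∀ α : Fin d → ℕ,
        ∫ x : Fin d → ℝ, ∏ i, x i ^ α i ∂ν = ∫ x : Fin d → ℝ, ∏ i, x i ^ α i ∂μ) →
      ν = μ := by
  intro ν _ hν hmom
  have : IsFiniteMeasure μ := finite_of_one (by simpa using hint 1)
  have : IsFiniteMeasure ν := finite_of_one (by simpa using hν 1)
  have hpe := poly_eq hint hν hmom
  have hmeas : ∀ j, Measurable (fun x : Fin d → ℝ => x j) := fun j => measurable_pi_apply j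
  -- polynomials are integrable for the marginals
  have hmi : ∀ (κ : Measure (Fin d → ℝ)),
      (∀ p : MvPolynomial (Fin d) ℝ, Integrable (fun x => MvPolynomial.eval x p) κ) →
      ∀ (j : Fin d) (p : Polynomial ℝ),
      Integrable (fun x => p.eval x) (Measure.map (fun x : Fin d → ℝ => x j) κ) := by
    intro κ hκ j p
    rw [integrable_map_measure p.continuous.aestronglyMeasurable (hmeas j).aemeasurable]
    have := hκ (Polynomial.aeval (MvPolynomial.X j) p)
    simp only [eval_aeval] at this
    exact this
  have hmap : ∀ j, Measure.map (fun x : Fin d → ℝ => x j) ν =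
      Measure.map (fun x : Fin d → ℝ => x j) μ := by
    intro j
    refine hmarg j _ (radon_of_finite _) (fun n => ?_) (fun n => ?_)
    · simpa using hmi ν hν j (Polynomial.X ^ n)
    · have hc : Continuous fun y : ℝ => y ^ n := continuous_pow n
      rw [integral_map (hmeas j).aemeasurable hc.aestronglyMeasurable,
        integral_map (hmeas j).aemeasurable hc.aestronglyMeasurable]
      simpa using hpe (MvPolynomial.X j ^ n)
  have c1 : Continuous fun y : ℝ => 1 / (1 + y ^ 2) :=
    Continuous.div (by fun_prop) (by fun_prop) (fun x => by positivity)
  have c2 : Continuous fun y : ℝ => y / (1 + y ^ 2) :=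
    Continuous.div (by fun_prop) (by fun_prop) (fun x => by positivity)
  have b1 : ∀ y : ℝ, |1 / (1 + y ^ 2)| ≤ 1 := fun y => by
    rw [abs_div, abs_one, abs_of_pos (by positivity : 0 < 1 + y ^ 2), div_le_one (by positivity)]
    nlinarith [sq_nonneg y]
  have b2 : ∀ y : ℝ, |y / (1 + y ^ 2)| ≤ 1 := fun y => by
    rw [abs_div, abs_of_pos (by positivity : 0 < 1 + y ^ 2), div_le_one (by positivity), ← sq_abs]
    nlinarith [sq_nonneg (|y| - 1), abs_nonneg y]
  let u : Fin d → BoundedContinuousFunction (Fin d → ℝ) ℝ := fun j =>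
    BoundedContinuousFunction.ofNormedAddCommGroup (fun x => 1 / (1 + (x j) ^ 2))
      (c1.comp (continuous_apply j)) 1 (fun x => b1 (x j))
  let v : Fin d → BoundedContinuousFunction (Fin d → ℝ) ℝ := fun j =>
    BoundedContinuousFunction.ofNormedAddCommGroup (fun x => x j / (1 + (x j) ^ 2))
      (c2.comp (continuous_apply j)) 1 (fun x => b2 (x j))
  let A : StarSubalgebra ℝ (BoundedContinuousFunction (Fin d → ℝ) ℝ) :=
    { Algebra.adjoin ℝ (Set.range u ∪ Set.range v) with
      star_mem' := by
        intro a ha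
        have : star a = a := by ext x; simp
        rw [this]; exact ha }
  have hA : ∀ g ∈ A, ∀ G, Good μ ν G → Good μ ν (fun x => g x * G x) := by
    intro g hg
    change g ∈ Algebra.adjoin ℝ (Set.range u ∪ Set.range v) at hg
    induction hg using Algebra.adjoin_induction with
    | mem g hg =>
      intro G hG
      rcases hg with ⟨j, rfl⟩ | ⟨j, rfl⟩
      · exact good_mul hint hν j (hmap j) c1 b1
          (fun δ hδ => (approx _ (hmi μ hint j) (hmarg j) δ hδ).1) hG
      · exact good_mul hint hν j (hmap j) c2 b2
          (fun δ hδ => (approx _ (hmi μ hint j) (hmarg j) δ hδ).2) hG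
    | algebraMap r => intro G hG; exact good_smul r hG
    | add f g _ _ hf hg =>
      intro G hG
      simpa only [BoundedContinuousFunction.coe_add, Pi.add_apply, add_mul] using
        good_add (hf G hG) (hg G hG)
    | mul f g _ _ hf hg =>
      intro G hG
      simpa only [BoundedContinuousFunction.coe_mul, Pi.mul_apply, mul_assoc] using
        hf _ (hg G hG)
  have hone : Good μ ν (fun _ => 1) := by
    intro P
    simp only [mul_one]
    exact ⟨memLp_poly hint P, memLp_poly hν P, hpe P⟩
  refine ext_of_forall_mem_subalgebra_integral_eq_of_polish (𝕜 := ℝ) (A := A) ?_ ?_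
  · intro x y hxy
    by_contra! hcon
    apply hxy
    have hu : ∀ j, u j x = u j y := fun j =>
      hcon _ ⟨_, ⟨u j, Algebra.subset_adjoin (Or.inl ⟨j, rfl⟩), rfl⟩, rfl⟩
    have hv : ∀ j, v j x = v j y := fun j =>
      hcon _ ⟨_, ⟨v j, Algebra.subset_adjoin (Or.inr ⟨j, rfl⟩), rfl⟩, rfl⟩
    funext j
    have h1 : 1 / (1 + (x j) ^ 2) = 1 / (1 + (y j) ^ 2) := hu j
    have h2 : x j / (1 + (x j) ^ 2) = y j / (1 + (y j) ^ 2) := hv j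
    rw [div_eq_mul_one_div, div_eq_mul_one_div (y j), h1] at h2
    exact mul_right_cancel₀ (by positivity) h2
  · intro g hg
    have := (hA g hg _ hone 1).2.2
    simpa using this
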